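/- arXiv:2201.01902 — 2 statements merged into one kernel-verified Lean document; each statement's English description precedes it below -/
import Mathlib

section
/- Let X be an integrable real-valued random variable whose distribution is symmetric around μ ∈ ℝ, meaning that 2μ − X has the same law as X. Then E[X · 1{X ∉ [0,1]}] ≤ 2 · max(μ, 0) · P(X ∉ [0,1]). -/
open MeasureTheory

/-- Averaging over the reflection `x ↦ 2μ - x`, the function `(x - 2μ₊) 1{x ∉ [0,1]}` is
nonpositive. -/
lemma indicator_not_mem_Icc_add_reflect_nonpos (μ x : ℝ) :
    Set.indicator {x : ℝ | x ∉ Set.Icc (0:ℝ) 1} (fun x => x - 2 * max μ 0) x +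
      Set.indicator {x : ℝ | x ∉ Set.Icc (0:ℝ) 1} (fun x => x - 2 * max μ 0) (2 * μ - x) ≤ 0 := by
  have h₁ := le_max_left μ 0
  have h₂ := le_max_right μ 0
  by_cases hx : x ∈ Set.Icc (0:ℝ) 1 <;> by_cases hy : 2 * μ - x ∈ Set.Icc (0:ℝ) 1 <;>
    simp only [Set.indicator, Set.mem_ofPred_eq, hx, hy, not_true_eq_false, not_false_eq_true,
      if_true, if_false] <;>
    simp only [Set.mem_Icc] at hx hy <;> linarith

/-- If `X` is an integrable real random variable whose law is symmetric around `μ`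
(i.e. `2μ - X` has the same law as `X`), then
`E[X · 1{X ∉ [0,1]}] ≤ 2 · max(μ, 0) · P(X ∉ [0,1])`. -/
theorem integral_indicator_not_mem_Icc_le
    {Ω : Type*} [MeasurableSpace Ω] (ℙ : Measure Ω) [IsProbabilityMeasure ℙ]
    (X : Ω → ℝ) (hXm : Measurable X) (hXint : Integrable X ℙ) (μ : ℝ)
    (hsym : Measure.map (fun ω => 2 * μ - X ω) ℙ = Measure.map X ℙ) :
    (∫ ω, X ω * Set.indicator {x : ℝ | x ∉ Set.Icc (0:ℝ) 1} (fun _ => (1:ℝ)) (X ω) ∂ℙ)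
      ≤ 2 * max μ 0 * (ℙ {ω | X ω ∉ Set.Icc (0:ℝ) 1}).toReal := by
  set S : Set ℝ := {x : ℝ | x ∉ Set.Icc (0:ℝ) 1}
  have hSm : MeasurableSet S := measurableSet_Icc.compl
  have hXS : MeasurableSet (X ⁻¹' S) := hXm hSm
  set g : ℝ → ℝ := S.indicator (fun x => x - 2 * max μ 0) with hg
  have hgm : Measurable g := (measurable_id.sub_const _).indicator hSm
  have hYm : Measurable (fun ω => 2 * μ - X ω) := hXm.const_sub _
  have hgX : Integrable (fun ω => g (X ω)) ℙ :=
    (hXint.sub (integrable_const (2 * max μ 0))).indicator hXS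
  have hgY : Integrable (fun ω => g (2 * μ - X ω)) ℙ :=
    (((integrable_const (2 * μ)).sub hXint).sub (integrable_const (2 * max μ 0))).indicator
      (hYm hSm)
  have hreflect : ∫ ω, g (2 * μ - X ω) ∂ℙ = ∫ ω, g (X ω) ∂ℙ := by
    rw [← integral_map hYm.aemeasurable hgm.aestronglyMeasurable, hsym,
      integral_map hXm.aemeasurable hgm.aestronglyMeasurable]
  have hsum : ∫ ω, g (X ω) ∂ℙ + ∫ ω, g (2 * μ - X ω) ∂ℙ ≤ 0 := by
    rw [← integral_add hgX hgY]
    exact integral_nonpos fun ω => indicator_not_mem_Icc_add_reflect_nonpos μ (X ω)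
  have hsplit : ∀ ω, X ω * S.indicator (fun _ => (1:ℝ)) (X ω) =
      g (X ω) + (X ⁻¹' S).indicator (fun _ => 2 * max μ 0) ω := by
    intro ω
    by_cases h : X ω ∈ S <;> simp [hg, h]
  have hconst : ∫ ω, (X ⁻¹' S).indicator (fun _ => 2 * max μ 0) ω ∂ℙ =
      2 * max μ 0 * (ℙ {ω | X ω ∉ Set.Icc (0:ℝ) 1}).toReal := by
    rw [integral_indicator_const _ hXS, smul_eq_mul, mul_comm]
    rfl
  rw [integral_congr_ae (ae_of_all _ hsplit),
    integral_add hgX ((integrable_const _).indicator hXS), hconst]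
  linarith
end

section
/- Let Σ₀ ∈ ℝ^{𝒜×𝒜} be symmetric positive definite such that Σ₀⁻¹ is strictly diagonally dominant (α(Σ₀⁻¹) > 0), let μ₀ ∈ ℝ^𝒜, and let σ > 0. Then for every diagonal matrix Λ with nonnegative diagonal entries and every vector r ∈ [0,1]^𝒜, each component of the vector (Σ₀⁻¹ + (1/σ²) Λ)⁻¹ (Σ₀⁻¹ μ₀ + (1/σ²) Λ r) is at most 2 · max_{a} |μ₀_a| + 1. -/
open Matrix Finset

/-- `ddGap A` is `α(A) = min_i (|A i i| - Σ_{j ≠ i} |A i j|)`; `A` is strictly diagonally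
dominant when `0 < ddGap A`. -/
noncomputable def ddGap {n : ℕ} (A : Matrix (Fin n) (Fin n) ℝ) : ℝ :=
  ⨅ i, (|A i i| - ∑ j ∈ Finset.univ.erase i, |A i j|)

/-- The infimum defining `ddGap` is a lower bound for the dominance gap of each row. -/
lemma ddGap_le {n : ℕ} (A : Matrix (Fin n) (Fin n) ℝ) (i : Fin n) :
    ddGap A ≤ |A i i| - ∑ j ∈ Finset.univ.erase i, |A i j| :=
  ciInf_le (Set.finite_range _).bddBelow i

/-- A maximum principle: if `A` is strictly row diagonally dominant with nonnegative diagonal,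
`w` is nonnegative and `(A + diag w) y = diag w v`, then `y` is bounded in sup norm by any
bound on `v`. -/
lemma abs_le_of_mulVec_add_eq {ι : Type*} [Fintype ι] [DecidableEq ι] (A : Matrix ι ι ℝ)
    (hdiag : ∀ i, 0 ≤ A i i) (hA : ∀ i, ∑ j ∈ Finset.univ.erase i, |A i j| < |A i i|)
    (w y v : ι → ℝ) (hw : ∀ i, 0 ≤ w i) (c : ℝ) (hv : ∀ i, |v i| ≤ c)
    (h : ∀ i, (A *ᵥ y) i + w i * y i = w i * v i) (i : ι) : |y i| ≤ c := by
  obtain ⟨k, -, hk⟩ := Finset.exists_max_image Finset.univ (fun j => |y j|) ⟨i, Finset.mem_univ i⟩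
  refine (hk i (Finset.mem_univ i)).trans ?_
  by_contra! hc
  have hc0 : 0 ≤ c := (abs_nonneg _).trans (hv k)
  have hsum : (A *ᵥ y) k = A k k * y k + ∑ j ∈ Finset.univ.erase k, A k j * y j :=
    (Finset.add_sum_erase Finset.univ (fun j => A k j * y j) (Finset.mem_univ k)).symm
  have heq : (A k k + w k) * y k = w k * v k - ∑ j ∈ Finset.univ.erase k, A k j * y j := by
    linarith [h k]
  have hoff : |∑ j ∈ Finset.univ.erase k, A k j * y j|
      ≤ (∑ j ∈ Finset.univ.erase k, |A k j|) * |y k| := by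
    rw [Finset.sum_mul]
    refine (Finset.abs_sum_le_sum_abs _ _).trans (Finset.sum_le_sum fun j _ => ?_)
    rw [abs_mul]
    exact mul_le_mul_of_nonneg_left (hk j (Finset.mem_univ j)) (abs_nonneg _)
  have habs : (A k k + w k) * |y k|
      ≤ w k * c + (∑ j ∈ Finset.univ.erase k, |A k j|) * |y k| := by
    calc (A k k + w k) * |y k| = |(A k k + w k) * y k| := by
          rw [abs_mul, abs_of_nonneg (add_nonneg (hdiag k) (hw k))]
      _ ≤ |w k * v k| + |∑ j ∈ Finset.univ.erase k, A k j * y j| := by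
          rw [heq]; exact abs_sub _ _
      _ ≤ _ := by
          rw [abs_mul, abs_of_nonneg (hw k)]
          exact add_le_add (mul_le_mul_of_nonneg_left (hv k) (hw k)) hoff
  have hgap := hA k
  rw [abs_of_nonneg (hdiag k)] at hgap
  have hpos := mul_pos (sub_pos.2 hgap) (hc0.trans_lt hc)
  have hnonneg := mul_nonneg (hw k) (sub_pos.2 hc).le
  linarith

/-- If `Σ₀` is symmetric positive definite with `Σ₀⁻¹` strictly diagonally dominant,
`σ > 0`, `Λ = diagonal d` is a diagonal matrix with nonnegative entries and `r ∈ [0,1]^𝒜`,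
then every component of the Gaussian posterior mean
`(Σ₀⁻¹ + σ⁻² Λ)⁻¹ (Σ₀⁻¹ μ₀ + σ⁻² Λ r)` is at most `2 max_a |μ₀ a| + 1`. -/
theorem posterior_mean_le_of_sdd
    {𝒜 : ℕ} (h𝒜 : 0 < 𝒜) (S₀ : Matrix (Fin 𝒜) (Fin 𝒜) ℝ) (hS₀ : S₀.PosDef)
    (hdd : 0 < ddGap S₀⁻¹) (μ₀ : Fin 𝒜 → ℝ) (σ : ℝ) (hσ : 0 < σ)
    (d : Fin 𝒜 → ℝ) (hd : ∀ i, 0 ≤ d i) (r : Fin 𝒜 → ℝ)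
    (hr : ∀ i, r i ∈ Set.Icc (0:ℝ) 1) :
    ∀ i, ((S₀⁻¹ + (σ ^ 2)⁻¹ • Matrix.diagonal d)⁻¹ *ᵥ
        (S₀⁻¹ *ᵥ μ₀ + (σ ^ 2)⁻¹ • (Matrix.diagonal d *ᵥ r))) i
      ≤ 2 * (⨆ a, |μ₀ a|) + 1 := by
  intro i
  have hP : (S₀⁻¹).PosDef := hS₀.inv
  have hσ' : 0 ≤ (σ ^ 2)⁻¹ := by positivity
  have hB : (S₀⁻¹ + (σ ^ 2)⁻¹ • Matrix.diagonal d).PosDef :=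
    hP.add_posSemidef ((Matrix.PosSemidef.diagonal hd).smul hσ')
  set x := (S₀⁻¹ + (σ ^ 2)⁻¹ • Matrix.diagonal d)⁻¹ *ᵥ
    (S₀⁻¹ *ᵥ μ₀ + (σ ^ 2)⁻¹ • (Matrix.diagonal d *ᵥ r)) with hx
  have hsol : (S₀⁻¹ + (σ ^ 2)⁻¹ • Matrix.diagonal d) *ᵥ x =
      S₀⁻¹ *ᵥ μ₀ + (σ ^ 2)⁻¹ • (Matrix.diagonal d *ᵥ r) := by
    rw [hx, Matrix.mulVec_mulVec,
      Matrix.mul_nonsing_inv _ ((Matrix.isUnit_iff_isUnit_det _).1 hB.isUnit), Matrix.one_mulVec]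
  have hM : ∀ a, |μ₀ a| ≤ ⨆ a, |μ₀ a| := le_ciSup (Set.finite_range _).bddAbove
  have hbound := abs_le_of_mulVec_add_eq S₀⁻¹ (fun _ => hP.diag_pos.le)
    (fun j => sub_pos.1 (hdd.trans_le (ddGap_le _ j)))
    (fun j => (σ ^ 2)⁻¹ * d j) (x - μ₀) (r - μ₀) (fun j => mul_nonneg hσ' (hd j))
    ((⨆ a, |μ₀ a|) + 1)
    (fun j => by
      have hμ := abs_le.1 (hM j)
      have hrj := hr j
      rw [Pi.sub_apply, abs_le]
      constructor <;> linarith [hrj.1, hrj.2])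
    (fun j => by
      have hj := congrFun hsol j
      simp only [Matrix.add_mulVec, Matrix.smul_mulVec, Pi.add_apply, Pi.smul_apply,
        Matrix.mulVec_diagonal, smul_eq_mul] at hj
      simp only [Matrix.mulVec_sub, Pi.sub_apply]
      linarith)
    i
  rw [Pi.sub_apply] at hbound
  linarith [(abs_le.1 hbound).2, (abs_le.1 (hM i)).2]
end
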